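/- Let m ≥ 2 and suppose P̃ ∈ ℝ[X] satisfies P̃·D_m = Q̃_m. Then P̃ has exactly s_m = 2^m − 2 distinct real roots; listing them as μ₁ < μ₂ < … < μ_{s_m}, they satisfy 0 < μ₁, μ_{s_m−1} < 5 < μ_{s_m} < 6. -/

import Mathlib

open Function

noncomputable section

/-- The polynomial map `f(x) = x(5-x)`. -/
def f (x : ℝ) : ℝ := x * (5 - x)

/-- `l(x) = x - 6`. -/
def lf (x : ℝ) : ℝ := x - 6

/-- `s(x) = (2-x)(4-x)(5-x) - (14-3x)`. -/
def sf (x : ℝ) : ℝ := (2 - x) * (4 - x) * (5 - x) - (14 - 3 * x)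

/-- `r(x) = -2(2-x)(5-x)`. -/
def rf (x : ℝ) : ℝ := -2 * (2 - x) * (5 - x)

/-- The decreasing inverse branch of `f`. -/
def phim (x : ℝ) : ℝ := (5 - Real.sqrt (25 - 4 * x)) / 2

/-- The increasing inverse branch of `f`. -/
def phip (x : ℝ) : ℝ := (5 + Real.sqrt (25 - 4 * x)) / 2

/-- `q m` is the function `q_m` from the paper, meaningful for `m ≥ 2`
(the values at `m = 0, 1` are junk values `1`, never used in the statements). -/
def q : ℕ → ℝ → ℝ
  | 0, _ => 1
  | 1, _ => 1
  | 2, x => sf x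
  | 3, x => sf (f x) * sf x - rf (f x) * lf x
  | m + 4, x =>
      sf (f^[m + 2] x) * q (m + 3) x - rf (f^[m + 2] x) * lf (f^[m + 1] x) * q (m + 2) x

/-- `s̃(x) = (4-x)(5-x) - 1`. -/
def st (x : ℝ) : ℝ := (4 - x) * (5 - x) - 1

/-- `r̃(x) = -2(5-x)`. -/
def rt (x : ℝ) : ℝ := -2 * (5 - x)

/-- `qt m` is the function `q̃_m` from the paper, meaningful for `m ≥ 2`. -/
def qt (m : ℕ) (x : ℝ) : ℝ :=
  if m = 2 then st x
  else if m = 3 then st (f x) * sf x - rt (f x) * lf x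
  else st (f^[m - 2] x) * q (m - 1) x - rt (f^[m - 2] x) * lf (f^[m - 3] x) * q (m - 2) x

open Polynomial

/-- The polynomial `F = 5X - X²`. -/
def F : ℝ[X] := C 5 * X - X ^ 2

/-- `Fiter i` is the `i`-fold composition `F^{(i)}`, with `Fiter 0 = X`. -/
def Fiter : ℕ → ℝ[X]
  | 0 => X
  | i + 1 => F.comp (Fiter i)

/-- Polynomial version of `l`. -/
def Lp : ℝ[X] := X - C 6

/-- Polynomial version of `s`. -/
def Sp : ℝ[X] := (C 2 - X) * (C 4 - X) * (C 5 - X) - (C 14 - C 3 * X)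

/-- Polynomial version of `r`. -/
def Rp : ℝ[X] := -C 2 * (C 2 - X) * (C 5 - X)

/-- `Qp m` is the polynomial `Q_m`, satisfying `(Qp m).eval x = q_m x`,
defined by the same recursion as `q_m`; meaningful for `m ≥ 2`. -/
def Qp : ℕ → ℝ[X]
  | 0 => 1
  | 1 => 1
  | 2 => Sp
  | 3 => Sp.comp (Fiter 1) * Sp - Rp.comp (Fiter 1) * Lp
  | m + 4 =>
      Sp.comp (Fiter (m + 2)) * Qp (m + 3) -
        Rp.comp (Fiter (m + 2)) * Lp.comp (Fiter (m + 1)) * Qp (m + 2)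

/-- `Dp m = ∏_{i=0}^{m-3} (F^{(i)} - 2)`, with `Dp 2 = 1`. -/
def Dp (m : ℕ) : ℝ[X] := ∏ i ∈ Finset.range (m - 2), (Fiter i - C 2)

/-- `r_m = 2^m + 2^{m-2} - 2`. -/
def rm (m : ℕ) : ℕ := 2 ^ m + 2 ^ (m - 2) - 2

/-- Polynomial version of `s̃`. -/
def Stp : ℝ[X] := (C 4 - X) * (C 5 - X) - 1

/-- Polynomial version of `r̃`. -/
def Rtp : ℝ[X] := -C 2 * (C 5 - X)

/-- `Qtp m` is the polynomial `Q̃_m`, satisfying `(Qtp m).eval x = q̃_m x`,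
defined by the same recursion as `q̃_m`; meaningful for `m ≥ 2`. -/
def Qtp : ℕ → ℝ[X]
  | 0 => 1
  | 1 => 1
  | 2 => Stp
  | 3 => Stp.comp (Fiter 1) * Sp - Rtp.comp (Fiter 1) * Lp
  | m + 4 =>
      Stp.comp (Fiter (m + 2)) * Qp (m + 3) -
        Rtp.comp (Fiter (m + 2)) * Lp.comp (Fiter (m + 1)) * Qp (m + 2)

/-- `s_m = 2^m - 2`. -/
def sm (m : ℕ) : ℕ := 2 ^ m - 2

/-- The reduced polynomials: `redP n` is `Q̃_{n+1}` divided by `D_{n+1}`, with `redP 0 = -1`. -/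
def redP : ℕ → ℝ[X]
  | 0 => -1
  | 1 => Stp
  | n + 2 =>
      (Sp * (redP (n + 1)).comp F - C 2 * Lp * (C 5 - F) * (redP n).comp (F.comp F)) /ₘ (X - C 2)

lemma eval_F (x : ℝ) : F.eval x = f x := by
  simp only [F, f, eval_sub, eval_mul, eval_C, eval_X, eval_pow]; ring

lemma eval_Sp (x : ℝ) : Sp.eval x = sf x := by simp [Sp, sf]

lemma eval_Lp (x : ℝ) : Lp.eval x = lf x := by simp [Lp, lf]

lemma eval_Rp (x : ℝ) : Rp.eval x = rf x := by simp [Rp, rf]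

lemma eval_Stp (x : ℝ) : Stp.eval x = st x := by simp [Stp, st]

lemma eval_Rtp (x : ℝ) : Rtp.eval x = rt x := by simp [Rtp, rt]

lemma eval_Fiter (i : ℕ) (x : ℝ) : (Fiter i).eval x = f^[i] x := by
  induction i with
  | zero => simp [Fiter]
  | succ i ih => rw [Fiter, eval_comp, ih, eval_F, Function.iterate_succ_apply']

/-! ### Expansion of the determinants along the finest level -/

lemma eval_Qp_left (n : ℕ) (x : ℝ) :
    (Qp (n + 3)).eval x =
      sf x * (Qp (n + 2)).eval (f x) - lf x * rf (f x) * (Qp (n + 1)).eval (f (f x)) := by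
  induction n using Nat.twoStepInduction with
  | zero =>
    simp only [Qp, eval_sub, eval_mul, eval_comp, eval_Fiter, eval_Sp, eval_Rp, eval_Lp, eval_one,
      Function.iterate_succ_apply, Function.iterate_zero_apply]
    ring
  | one =>
    simp only [Qp, eval_sub, eval_mul, eval_comp, eval_Fiter, eval_Sp, eval_Rp, eval_Lp,
      Function.iterate_succ_apply, Function.iterate_zero_apply]
    ring
  | more n ih₀ ih₁ =>
    have key (k : ℕ) (y : ℝ) : (Qp (k + 3)).eval y =
        sf (f^[k + 1] y) * (Qp (k + 2)).eval y -
          rf (f^[k + 1] y) * lf (f^[k] y) * (Qp (k + 1)).eval y := by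
      cases k <;> simp [Qp, eval_comp, eval_Fiter, eval_Sp, eval_Rp, eval_Lp]
    rw [key (n + 2) x, ih₀, ih₁, key (n + 1) (f x), key n (f (f x))]
    simp only [Function.iterate_succ_apply]
    ring

lemma eval_Qtp_right (k : ℕ) (y : ℝ) : (Qtp (k + 3)).eval y =
    st (f^[k + 1] y) * (Qp (k + 2)).eval y -
      rt (f^[k + 1] y) * lf (f^[k] y) * (Qp (k + 1)).eval y := by
  cases k <;>
    simp [Qtp, Qp, eval_comp, eval_Fiter, eval_Sp, eval_Stp, eval_Rtp, eval_Lp]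

lemma eval_Qtp_left (n : ℕ) (x : ℝ) :
    (Qtp (n + 4)).eval x =
      sf x * (Qtp (n + 3)).eval (f x) - lf x * rf (f x) * (Qtp (n + 2)).eval (f (f x)) := by
  cases n with
  | zero =>
    simp only [Qtp, Qp, eval_sub, eval_mul, eval_comp, eval_Fiter, eval_Sp, eval_Rp, eval_Lp,
      eval_Stp, eval_Rtp, Function.iterate_succ_apply, Function.iterate_zero_apply]
    ring
  | succ n =>
    rw [eval_Qtp_right (n + 2) x, eval_Qp_left (n + 1) x, eval_Qp_left n x,
      eval_Qtp_right (n + 1) (f x), eval_Qtp_right n (f (f x))]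
    simp only [Function.iterate_succ_apply]
    ring

lemma eval_Dp (m : ℕ) (x : ℝ) :
    (Dp m).eval x = ∏ i ∈ Finset.range (m - 2), (f^[i] x - 2) := by
  simp [Dp, eval_prod, eval_Fiter]

lemma eval_Dp_succ (n : ℕ) (x : ℝ) :
    (Dp (n + 3)).eval x = (x - 2) * (Dp (n + 2)).eval (f x) := by
  rw [eval_Dp, eval_Dp, show n + 3 - 2 = n + 1 by omega, show n + 2 - 2 = n by omega,
    Finset.prod_range_succ']
  simp only [Function.iterate_succ_apply, Function.iterate_zero_apply]
  ring

/-! ### The reduced polynomials -/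

lemma redP_recursion_of_eval_six (n : ℕ)
    (h : (redP (n + 1)).eval 6 = -(redP n).eval (-6)) (x : ℝ) :
    (x - 2) * (redP (n + 2)).eval x =
      sf x * (redP (n + 1)).eval (f x) - 2 * lf x * (5 - f x) * (redP n).eval (f (f x)) := by
  have hroot : IsRoot
      (Sp * (redP (n + 1)).comp F - C 2 * Lp * (C 5 - F) * (redP n).comp (F.comp F)) 2 := by
    simp only [IsRoot.def, eval_sub, eval_mul, eval_comp, eval_C, eval_F, eval_Sp, eval_Lp]
    rw [show f 2 = 6 by norm_num [f], show f 6 = -6 by norm_num [f], h]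
    norm_num [sf, lf]
  have h2 := congrArg (Polynomial.eval x) (mul_divByMonic_eq_iff_isRoot.2 hroot)
  rw [← redP] at h2
  simpa [eval_comp, eval_F, eval_Sp, eval_Lp] using h2

lemma redP_eval_six (n : ℕ) : (redP (n + 1)).eval 6 = -(redP n).eval (-6) := by
  induction n with
  | zero => norm_num [redP, eval_Stp, st]
  | succ n ih =>
    have h := redP_recursion_of_eval_six n ih 6
    rw [show f 6 = -6 by norm_num [f]] at h
    norm_num [sf, lf] at h
    linarith

lemma redP_recursion (n : ℕ) (x : ℝ) :
    (x - 2) * (redP (n + 2)).eval x =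
      sf x * (redP (n + 1)).eval (f x) - 2 * lf x * (5 - f x) * (redP n).eval (f (f x)) :=
  redP_recursion_of_eval_six n (redP_eval_six n) x

lemma eval_redP_mul_Dp (n : ℕ) (x : ℝ) :
    (redP (n + 1)).eval x * (Dp (n + 2)).eval x = (Qtp (n + 2)).eval x := by
  induction n using Nat.twoStepInduction generalizing x with
  | zero => simp [redP, Dp, Qtp]
  | one =>
    have h := redP_recursion 0 x
    rw [eval_Dp_succ]
    simp only [redP, eval_neg, eval_one, eval_Stp] at h
    simp only [redP, zero_add, Dp, Qtp, eval_sub, eval_mul, eval_comp, eval_Fiter,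
      eval_Sp, eval_Lp, eval_Stp, eval_Rtp, Function.iterate_one, Nat.sub_self,
      Finset.range_zero, Finset.prod_empty, eval_one, rt] at h ⊢
    linarith
  | more n ih₀ ih₁ =>
    have h := redP_recursion (n + 1) x
    rw [eval_Qtp_left, ← ih₀, ← ih₁, eval_Dp_succ, eval_Dp_succ]
    simp only [rf]
    linear_combination (f x - 2) * (Dp (n + 2)).eval (f (f x)) * h

lemma redP_mul_Dp (n : ℕ) : redP (n + 1) * Dp (n + 2) = Qtp (n + 2) :=
  Polynomial.funext fun x => by rw [eval_mul, eval_redP_mul_Dp]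

lemma natDegree_F_le : F.natDegree ≤ 2 := by unfold F; compute_degree

lemma Fiter_ne_C (i : ℕ) (c : ℝ) : Fiter i - C c ≠ 0 := by
  have hF : F.natDegree = 2 := by unfold F; compute_degree!
  have hdeg : (Fiter i).natDegree = 2 ^ i := by
    induction i with
    | zero => simp [Fiter]
    | succ i ih => rw [Fiter, natDegree_comp, ih, hF, pow_succ, mul_comm]
  intro h
  have h2 : (Fiter i - C c).natDegree = 2 ^ i := by rw [natDegree_sub_C, hdeg]
  rw [h, natDegree_zero] at h2
  exact (pow_pos (by norm_num) i).ne h2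

lemma natDegree_redP_le (n : ℕ) : (redP n).natDegree ≤ 2 ^ (n + 1) - 2 := by
  induction n using Nat.twoStepInduction with
  | zero => simp [redP]
  | one => unfold redP Stp; norm_num; compute_degree
  | more n ih₀ ih₁ =>
    have hpos : 1 ≤ 2 ^ n := Nat.one_le_two_pow
    have hS : Sp.natDegree ≤ 3 := by unfold Sp; compute_degree
    have hL : Lp.natDegree ≤ 1 := by unfold Lp; compute_degree
    have hF := natDegree_F_le
    have hFF : (F.comp F).natDegree ≤ 4 := natDegree_comp_le.trans (Nat.mul_le_mul hF hF)
    have h₁ : ((redP (n + 1)).comp F).natDegree ≤ (2 ^ (n + 2) - 2) * 2 :=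
      natDegree_comp_le.trans (Nat.mul_le_mul ih₁ hF)
    have h₀ : ((redP n).comp (F.comp F)).natDegree ≤ (2 ^ (n + 1) - 2) * 4 :=
      natDegree_comp_le.trans (Nat.mul_le_mul ih₀ hFF)
    have h5F : (C 5 - F).natDegree ≤ 2 :=
      (natDegree_sub_le _ _).trans (max_le (by simp) hF)
    have hA : (Sp * (redP (n + 1)).comp F).natDegree ≤ 3 + (2 ^ (n + 2) - 2) * 2 :=
      natDegree_mul_le_of_le hS h₁
    have hB : (C 2 * Lp * (C 5 - F) * (redP n).comp (F.comp F)).natDegree ≤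
        0 + 1 + 2 + (2 ^ (n + 1) - 2) * 4 :=
      natDegree_mul_le_of_le (natDegree_mul_le_of_le
        (natDegree_mul_le_of_le (by simp) hL) h5F) h₀
    rw [redP, natDegree_divByMonic _ (monic_X_sub_C 2), natDegree_X_sub_C]
    have hAB := natDegree_sub_le (Sp * (redP (n + 1)).comp F)
      (C 2 * Lp * (C 5 - F) * (redP n).comp (F.comp F))
    simp only [pow_succ] at *
    omega

/-! ### Signs on the non-positive half-line and at the points `5` and `6` -/

lemma f_nonpos {x : ℝ} (hx : x ≤ 0) : f x ≤ 0 := by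
  unfold f; nlinarith

lemma redP_sign_nonpos (n : ℕ) : ∀ x : ℝ, x ≤ 0 →
    0 < (-1) ^ (n + 1) * (redP n).eval x ∧
      2 * (5 - x) * ((-1) ^ (n + 1) * (redP n).eval (f x)) <
        (-1) ^ (n + 2) * (redP (n + 1)).eval x := by
  induction n with
  | zero =>
    intro x hx
    simp only [redP, eval_neg, eval_one, eval_Stp, st]
    constructor <;> norm_num
    nlinarith
  | succ n ih =>
    intro x hx
    obtain ⟨-, hb⟩ := ih x hx
    obtain ⟨ha', hb'⟩ := ih (f x) (f_nonpos hx)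
    obtain ⟨ha'', -⟩ := ih (f (f x)) (f_nonpos (f_nonpos hx))
    have hpos : 0 < (-1) ^ (n + 2) * (redP (n + 1)).eval x := by
      refine lt_trans ?_ hb
      have : 0 < 5 - x := by linarith
      positivity
    refine ⟨hpos, ?_⟩
    have hfx : 0 < 5 - f x := by linarith [f_nonpos hx]
    have hb0 : 0 < (-1) ^ (n + 2) * (redP (n + 1)).eval (f x) := by
      refine lt_trans ?_ hb'
      positivity
    have hrec := redP_recursion n x
    have hrec' : (2 - x) * ((-1) ^ (n + 3) * (redP (n + 2)).eval x) =
        sf x * ((-1) ^ (n + 2) * (redP (n + 1)).eval (f x)) -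
          (6 - x) * (2 * (5 - f x) * ((-1) ^ (n + 1) * (redP n).eval (f (f x)))) := by
      rw [pow_succ _ (n + 2), pow_succ _ (n + 1)]
      simp only [lf] at hrec
      linear_combination -(-1) ^ (n + 1) * hrec
    set A := (-1) ^ (n + 2) * (redP (n + 1)).eval (f x)
    have hlt : (6 - x) * (2 * (5 - f x) * ((-1) ^ (n + 1) * (redP n).eval (f (f x)))) <
        (6 - x) * A := mul_lt_mul_of_pos_left hb' (by linarith)
    have hcoef : 2 * (2 - x) * (5 - x) ≤ sf x - (6 - x) := by
      have : sf x - (6 - x) - 2 * (2 - x) * (5 - x) = (5 - x) * (-x) * (4 - x) := by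
        simp only [sf]; ring
      have h2 : 0 ≤ (5 - x) * (-x) * (4 - x) :=
        mul_nonneg (mul_nonneg (by linarith) (by linarith)) (by linarith)
      linarith
    have := mul_le_mul_of_nonneg_right hcoef hb0.le
    refine lt_of_mul_lt_mul_left (a := 2 - x) ?_ (by linarith)
    rw [hrec']
    linarith

lemma redP_sign_five (n : ℕ) : 0 < (-1) ^ n * (redP (n + 2)).eval 5 := by
  have h := redP_recursion n 5
  have hf : f 5 = 0 := by norm_num [f]
  have hf0 : f 0 = 0 := by norm_num [f]
  obtain ⟨-, hb⟩ := redP_sign_nonpos n 0 le_rfl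
  rw [hf, hf0] at h
  rw [hf0] at hb
  norm_num [sf, lf] at h
  simp only [pow_succ] at hb
  have h3 := congrArg ((-1) ^ n * ·) h
  linarith

lemma redP_sign_six (n : ℕ) : 0 < (-1) ^ (n + 1) * (redP (n + 2)).eval 6 := by
  obtain ⟨hb, -⟩ := redP_sign_nonpos (n + 1) (-6) (by norm_num)
  rw [redP_eval_six]
  simp only [pow_succ] at hb ⊢
  linarith

/-! ### Inverse branches -/

lemma f_phim {z : ℝ} (hz : z < 6) : f (phim z) = z := by
  have := Real.sq_sqrt (show 0 ≤ 25 - 4 * z by linarith)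
  simp only [f, phim]
  nlinarith

lemma f_phip {z : ℝ} (hz : z < 6) : f (phip z) = z := by
  have := Real.sq_sqrt (show 0 ≤ 25 - 4 * z by linarith)
  simp only [f, phip]
  nlinarith

lemma one_lt_sqrt_branch {z : ℝ} (hz : z < 6) : 1 < √(25 - 4 * z) :=
  Real.lt_sqrt_of_sq_lt (by linarith)

lemma sqrt_branch_lt_five {z : ℝ} (hz : 0 < z) : √(25 - 4 * z) < 5 := by
  rw [Real.sqrt_lt' (by norm_num)]; linarith

lemma sqrt_branch_lt {z w : ℝ} (h : z < w) (hw : w < 6) :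
    √(25 - 4 * w) < √(25 - 4 * z) :=
  Real.sqrt_lt_sqrt (by linarith) (by linarith)

/-! ### Polynomials with a full set of simple real roots -/

lemma eval_eq_const_mul_prod {g : ℝ[X]} {N : ℕ} {u : ℕ → ℝ} (hdeg : g.natDegree ≤ N)
    (hu : StrictMonoOn u (Set.Iio N)) (hroot : ∀ k < N, g.eval (u k) = 0) :
    ∃ c : ℝ, ∀ x, g.eval x = c * ∏ k ∈ Finset.range N, (x - u k) := by
  have hdvd : (∏ k ∈ Finset.range N, (X - C (u k))) ∣ g := by
    refine Finset.prod_dvd_of_coprime ?_ ?_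
    · intro i hi j hj hij
      refine isCoprime_X_sub_C_of_isUnit_sub (sub_ne_zero.2 fun h => hij ?_).isUnit
      exact hu.injOn (by simpa using hi) (by simpa using hj) h
    · intro k hk
      exact dvd_iff_isRoot.2 (hroot k (Finset.mem_range.1 hk))
  obtain ⟨h, rfl⟩ := hdvd
  have hmonic : (∏ k ∈ Finset.range N, (X - C (u k))).Monic :=
    monic_prod_of_monic _ _ fun k _ => monic_X_sub_C _
  have hdegprod : (∏ k ∈ Finset.range N, (X - C (u k))).natDegree = N := by
    rw [natDegree_prod_of_monic _ _ fun k _ => monic_X_sub_C _]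
    simp
  have hh : h.natDegree = 0 := by
    by_cases h0 : h = 0
    · simp [h0]
    · rw [hmonic.natDegree_mul' h0, hdegprod] at hdeg
      omega
  refine ⟨h.coeff 0, fun x => ?_⟩
  rw [eq_C_of_natDegree_eq_zero hh]
  simp [eval_prod, mul_comm]

lemma prod_sub_sign {u : ℕ → ℝ} {N j : ℕ} {t : ℝ} (hj : j ≤ N)
    (hlt : ∀ k < j, u k < t) (hgt : ∀ k, j ≤ k → k < N → t < u k) :
    0 < (-1) ^ (N + j) * ∏ k ∈ Finset.range N, (t - u k) := by
  obtain ⟨d, rfl⟩ := Nat.exists_eq_add_of_le hj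
  have h1 : 0 < ∏ k ∈ Finset.range j, (t - u k) :=
    Finset.prod_pos fun k hk => sub_pos.2 (hlt k (Finset.mem_range.1 hk))
  have h2 : 0 < ∏ k ∈ Finset.range d, (u (j + k) - t) :=
    Finset.prod_pos fun k hk => by
      have := Finset.mem_range.1 hk
      exact sub_pos.2 (hgt _ (by omega) (by omega))
  have h3 : ∏ k ∈ Finset.range d, (t - u (j + k)) =
      (-1) ^ d * ∏ k ∈ Finset.range d, (u (j + k) - t) := by
    rw [← Finset.card_range d, ← Finset.prod_const, Finset.card_range, ← Finset.prod_mul_distrib]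
    exact Finset.prod_congr rfl fun k _ => by ring
  have h4 : (-1 : ℝ) ^ (j + d + j) * (-1) ^ d = 1 := by
    rw [← pow_add]; exact Even.neg_one_pow ⟨j + d, by ring⟩
  rw [Finset.prod_range_add, h3]
  calc (0 : ℝ) < (∏ k ∈ Finset.range j, (t - u k)) * ∏ k ∈ Finset.range d, (u (j + k) - t) :=
        mul_pos h1 h2
    _ = ((-1 : ℝ) ^ (j + d + j) * (-1) ^ d) * ((∏ k ∈ Finset.range j, (t - u k)) *
          ∏ k ∈ Finset.range d, (u (j + k) - t)) := by rw [h4, one_mul]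
    _ = _ := by ring

/-- A polynomial with a full set of simple roots `u 0 < u 1 < ⋯`, all to the right of `a`,
changes sign at each of them. -/
lemma sign_between_roots {g : ℝ[X]} {N : ℕ} {u : ℕ → ℝ} {a ε : ℝ} (hdeg : g.natDegree ≤ N)
    (hu : StrictMonoOn u (Set.Iio N)) (hroot : ∀ k < N, g.eval (u k) = 0)
    (ha : ∀ k < N, a < u k) (hε : 0 < ε * g.eval a) {j : ℕ} {t : ℝ} (hj : j ≤ N)
    (hlt : ∀ k < j, u k < t) (hgt : ∀ k, j ≤ k → k < N → t < u k) :
    0 < ε * (-1) ^ j * g.eval t := by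
  obtain ⟨c, hc⟩ := eval_eq_const_mul_prod hdeg hu hroot
  have h0 := prod_sub_sign (u := u) (N := N) (j := 0) (t := a) (Nat.zero_le _) (by simp)
    (fun k _ hk => ha k hk)
  have h1 := prod_sub_sign hj hlt hgt
  rw [hc] at hε ⊢
  have hone : (-1 : ℝ) ^ N * (-1) ^ N = 1 := by
    rw [← pow_add]; exact Even.neg_one_pow ⟨N, rfl⟩
  rw [add_zero] at h0
  rw [pow_add] at h1
  set A := ∏ k ∈ Finset.range N, (a - u k)
  set B := ∏ k ∈ Finset.range N, (t - u k)
  have hεc : 0 < ε * c * (-1) ^ N := by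
    refine pos_of_mul_pos_left (b := (-1) ^ N * A) ?_ h0.le
    linear_combination hε + (-(ε * c * A)) * hone
  have := mul_pos hεc h1
  linear_combination this + (ε * c * (-1) ^ j * B) * hone

lemma exists_root_of_mul_neg {g : ℝ[X]} {a b ε : ℝ} (hab : a < b)
    (ha : 0 < ε * g.eval a) (hb : 0 < -ε * g.eval b) :
    ∃ t, a < t ∧ t < b ∧ g.eval t = 0 := by
  have hcont : ContinuousOn (fun x => ε * g.eval x) (Set.Icc a b) :=
    (continuous_const.mul g.continuous).continuousOn
  obtain ⟨t, ht, h0⟩ := intermediate_value_Ioo' hab.le hcont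
    (show (0 : ℝ) ∈ Set.Ioo (ε * g.eval b) (ε * g.eval a) from ⟨by linarith, ha⟩)
  have hε : ε ≠ 0 := by rintro rfl; simp at ha
  exact ⟨t, ht.1, ht.2, (mul_eq_zero.1 h0).resolve_left hε⟩

/-! ### The inductive interlacing statement -/

/-- `y 0 < ⋯ < y (K + 1)` are roots of `redP (n + 1)` in `(0, 6)`, all but the last one below `5`,
and the signs of `redP n ∘ f` alternate along them except for the last step. -/
structure RootChain (n K : ℕ) (y : ℕ → ℝ) : Prop where
  strictMono : StrictMonoOn y (Set.Iio (K + 2))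
  root : ∀ j < K + 2, (redP (n + 1)).eval (y j) = 0
  pos : 0 < y 0
  lt_five : y K < 5
  five_lt : 5 < y (K + 1)
  lt_six : y (K + 1) < 6
  sign : ∀ j ≤ K, 0 < (-1) ^ (n + 1 + j) * (redP n).eval (f (y j))
  sign_last : 0 < (-1) ^ (n + 1) * (redP n).eval (f (y (K + 1)))

lemma rootChain_zero : ∃ y, RootChain 0 0 y := by
  have h5 := Real.sq_sqrt (show (0 : ℝ) ≤ 5 by norm_num)
  have h5a : (2 : ℝ) < √5 := Real.lt_sqrt_of_sq_lt (by norm_num)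
  have h5b : √(5 : ℝ) < 3 := by rw [Real.sqrt_lt' (by norm_num)]; norm_num
  refine ⟨fun j => if j = 0 then (9 - √5) / 2 else (9 + √5) / 2, ?_, ?_, ?_, ?_, ?_, ?_, ?_, ?_⟩
  · intro i hi j hj hij
    simp only [Set.mem_Iio] at hi hj
    obtain rfl : i = 0 := by omega
    obtain rfl : j = 1 := by omega
    norm_num
    linarith
  · intro j hj
    rcases (show j = 0 ∨ j = 1 by omega) with rfl | rfl <;>
      norm_num [redP, eval_Stp, st] <;> nlinarith
  · norm_num; linarith
  · norm_num; linarith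
  · norm_num; linarith
  · norm_num; linarith
  · intro j hj
    obtain rfl : j = 0 := by omega
    norm_num [redP]
  · norm_num [redP]

/-- The preimages under `f` of the points `y 0 < ⋯ < y (K + 1)`, in increasing order. -/
def preimages (K : ℕ) (y : ℕ → ℝ) (j : ℕ) : ℝ :=
  if j < K + 2 then phim (y j) else phip (y (2 * K + 3 - j))

/-- The preimages together with the points `0`, `5`, `6`. -/
def nodes (K : ℕ) (y : ℕ → ℝ) (j : ℕ) : ℝ :=
  if j = 0 then 0 else if j < 2 * K + 5 then preimages K y (j - 1)
  else if j = 2 * K + 5 then 5 else 6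

namespace RootChain

variable {n K : ℕ} {y : ℕ → ℝ}

lemma pos_of_lt (h : RootChain n K y) {j : ℕ} (hj : j < K + 2) : 0 < y j := by
  rcases Nat.eq_zero_or_pos j with rfl | hpos
  · exact h.pos
  · exact h.pos.trans (h.strictMono (by simp) hj hpos)

lemma lt_six_of_lt (h : RootChain n K y) {j : ℕ} (hj : j < K + 2) : y j < 6 :=
  (h.strictMono.monotoneOn hj (by simp) (by omega)).trans_lt h.lt_six

lemma lt_five_of_le (h : RootChain n K y) {j : ℕ} (hj : j ≤ K) : y j < 5 :=
  (h.strictMono.monotoneOn (by simp; omega) (by simp) hj).trans_lt h.lt_five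

lemma preimages_strictMono (h : RootChain n K y) :
    StrictMonoOn (preimages K y) (Set.Iio (2 * K + 4)) := by
  intro i hi j hj hij
  simp only [Set.mem_Iio] at hi hj
  unfold preimages
  split_ifs with h1 h2 h2
  · have := sqrt_branch_lt (h.strictMono h1 h2 hij) (h.lt_six_of_lt h2)
    unfold phim; linarith
  · have h3 := one_lt_sqrt_branch (h.lt_six_of_lt h1)
    have h4 := one_lt_sqrt_branch (h.lt_six_of_lt (j := 2 * K + 3 - j) (by omega))
    unfold phim phip; linarith
  · omega
  · have h3 : 2 * K + 3 - i < K + 2 := by omega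
    have h4 : 2 * K + 3 - j < K + 2 := by omega
    have := sqrt_branch_lt (h.strictMono h4 h3 (by omega)) (h.lt_six_of_lt h3)
    unfold phip; linarith

lemma preimages_mem (h : RootChain n K y) {j : ℕ} (hj : j < 2 * K + 4) :
    0 < preimages K y j ∧ preimages K y j < 5 := by
  unfold preimages
  split_ifs with h1
  · have h3 := one_lt_sqrt_branch (h.lt_six_of_lt h1)
    have h4 := sqrt_branch_lt_five (h.pos_of_lt h1)
    unfold phim
    constructor <;> linarith
  · have h2 : 2 * K + 3 - j < K + 2 := by omega
    have h3 := one_lt_sqrt_branch (h.lt_six_of_lt h2)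
    have h4 := sqrt_branch_lt_five (h.pos_of_lt h2)
    unfold phip
    constructor <;> linarith

lemma eval_comp_preimages (h : RootChain n K y) {j : ℕ} (hj : j < 2 * K + 4) :
    ((redP (n + 1)).comp F).eval (preimages K y j) = 0 := by
  rw [eval_comp, eval_F]
  unfold preimages
  split_ifs with h1
  · rw [f_phim (h.lt_six_of_lt h1), h.root _ h1]
  · have h2 : 2 * K + 3 - j < K + 2 := by omega
    rw [f_phip (h.lt_six_of_lt h2), h.root _ h2]

/-- At a preimage of a root of `redP (n + 1)`, the value of `redP (n + 2)` is governed by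
`redP n ∘ f` at this root. -/
lemma recursion_at_preimage (h : RootChain n K y) {j : ℕ} (hj : j < K + 2) {u : ℝ}
    (hu : f u = y j) :
    (2 - u) * (redP (n + 2)).eval u =
      -(2 * (6 - u) * ((5 - y j) * (redP n).eval (f (y j)))) := by
  have hrec := redP_recursion n u
  rw [hu, h.root j hj] at hrec
  simp only [lf] at hrec
  linear_combination -hrec

lemma sign_mul (h : RootChain n K y) (hK : Even K) {j : ℕ} (hj : j < K + 2) :
    0 < (-1) ^ (n + 1 + j) * ((5 - y j) * (redP n).eval (f (y j))) := by
  rcases Nat.lt_succ_iff_lt_or_eq.1 hj with hj' | rfl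
  · have := mul_pos (sub_pos.2 (h.lt_five_of_le (Nat.lt_succ_iff.1 hj')))
      (h.sign j (Nat.lt_succ_iff.1 hj'))
    linear_combination this
  · have := mul_pos (sub_pos.2 h.five_lt) h.sign_last
    have hodd : (-1 : ℝ) ^ (K + 1) = -1 := Odd.neg_one_pow hK.add_one
    rw [pow_add _ _ (K + 1), hodd]
    linear_combination this

lemma sign_preimages (h : RootChain n K y) (hK : Even K) {j : ℕ} (hj : j < 2 * K + 4) :
    0 < (-1) ^ (n + j) * (redP (n + 2)).eval (preimages K y j) := by
  have hmem := h.preimages_mem hj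
  unfold preimages at hmem ⊢
  split_ifs at hmem ⊢ with h1
  · have hrec := h.recursion_at_preimage h1 (f_phim (h.lt_six_of_lt h1))
    have hs := h.sign_mul hK h1
    have h2 : 0 < 2 - phim (y j) := by
      have := one_lt_sqrt_branch (h.lt_six_of_lt h1)
      unfold phim; linarith
    refine pos_of_mul_pos_right (a := 2 - phim (y j)) ?_ h2.le
    have hp := mul_pos (show 0 < 2 * (6 - phim (y j)) by linarith) hs
    rw [show n + 1 + j = n + j + 1 by ring, pow_succ] at hp
    linear_combination hp + (-(-1) ^ (n + j)) * hrec
  · obtain ⟨i, hi⟩ : ∃ i, 2 * K + 3 - j = i := ⟨_, rfl⟩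
    rw [hi] at hmem ⊢
    have h3 : i < K + 2 := by omega
    have hrec := h.recursion_at_preimage h3 (f_phip (h.lt_six_of_lt h3))
    have hs := h.sign_mul hK h3
    have h2 : 0 < phip (y i) - 2 := by
      have := one_lt_sqrt_branch (h.lt_six_of_lt h3)
      unfold phip; linarith
    have hpar : (-1 : ℝ) ^ (n + 1 + i) = (-1) ^ (n + j) := by
      refine neg_one_pow_congr ?_
      have : i + j = 2 * K + 3 := by omega
      grind
    refine pos_of_mul_pos_right (a := phip (y i) - 2) ?_ h2.le
    have hp := mul_pos (show 0 < 2 * (6 - phip (y i)) by linarith) hs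
    rw [hpar] at hp
    linear_combination hp + ((-1) ^ (n + j)) * hrec

lemma nodes_lt_succ (h : RootChain n K y) {j : ℕ} (hj : j < 2 * K + 6) :
    nodes K y j < nodes K y (j + 1) := by
  unfold nodes
  rcases Nat.eq_zero_or_pos j with rfl | hpos
  · simpa using (h.preimages_mem (j := 0) (by omega)).1
  rcases lt_trichotomy j (2 * K + 4) with h1 | rfl | h1
  · rw [if_neg (by omega), if_pos (by omega), if_neg (by omega), if_pos (by omega)]
    exact h.preimages_strictMono (by simp; omega) (by simp; omega) (by omega)
  · rw [if_neg (by omega), if_pos (by omega), if_neg (by omega), if_neg (by omega),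
      if_pos (by omega)]
    exact (h.preimages_mem (by omega)).2
  · rw [if_neg (by omega), if_neg (by omega), if_pos (by omega), if_neg (by omega),
      if_neg (by omega), if_neg (by omega)]
    norm_num

lemma sign_nodes (h : RootChain n K y) (hK : Even K) {j : ℕ} (hj : j ≤ 2 * K + 6) :
    0 < (-1) ^ (n + 1 + j) * (redP (n + 2)).eval (nodes K y j) := by
  unfold nodes
  split_ifs with h0 h1 h2
  · subst h0
    have := (redP_sign_nonpos (n + 2) 0 le_rfl).1
    rwa [neg_one_pow_congr (show Even (n + 1 + 0) ↔ Even (n + 2 + 1) by grind)]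
  · have := h.sign_preimages hK (j := j - 1) (by omega)
    rwa [neg_one_pow_congr (show Even (n + 1 + j) ↔ Even (n + (j - 1)) by grind)]
  · subst h2
    have := redP_sign_five n
    rwa [neg_one_pow_congr (show Even (n + 1 + (2 * K + 5)) ↔ Even n by grind)]
  · have := redP_sign_six n
    rwa [neg_one_pow_congr (show Even (n + 1 + j) ↔ Even (n + 1) by grind)]

lemma sign_comp (h : RootChain n K y) (hKn : K + 4 = 2 ^ (n + 2)) {j : ℕ} {t : ℝ}
    (hj : j ≤ 2 * K + 4) (hlt : ∀ k < j, preimages K y k < t)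
    (hgt : ∀ k, j ≤ k → k < 2 * K + 4 → t < preimages K y k) :
    0 < (-1) ^ (n + 2 + j) * (redP (n + 1)).eval (f t) := by
  have hdeg : ((redP (n + 1)).comp F).natDegree ≤ 2 * K + 4 := by
    have h1 := natDegree_redP_le (n + 1)
    have h2 : ((redP (n + 1)).comp F).natDegree ≤ (2 ^ (n + 2) - 2) * 2 :=
      natDegree_comp_le.trans (Nat.mul_le_mul h1 natDegree_F_le)
    omega
  have h0 : 0 < (-1) ^ (n + 2) * ((redP (n + 1)).comp F).eval 0 := by
    rw [eval_comp, eval_F, show f 0 = 0 by norm_num [f]]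
    exact (redP_sign_nonpos (n + 1) 0 le_rfl).1
  have := sign_between_roots hdeg h.preimages_strictMono (fun k hk => h.eval_comp_preimages hk)
    (fun k hk => (h.preimages_mem hk).1) h0 hj hlt hgt
  rwa [eval_comp, eval_F, ← pow_add] at this

lemma exists_succ (h : RootChain n K y) (hK : Even K) (hKn : K + 4 = 2 ^ (n + 2)) :
    ∃ t, RootChain (n + 1) (2 * K + 4) t := by
  have hex (j : ℕ) : ∃ t, j < 2 * K + 6 →
      nodes K y j < t ∧ t < nodes K y (j + 1) ∧ (redP (n + 2)).eval t = 0 := by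
    by_cases hj : j < 2 * K + 6
    · obtain ⟨t, ht⟩ := exists_root_of_mul_neg (h.nodes_lt_succ hj) (h.sign_nodes hK hj.le) (by
        have := h.sign_nodes hK (j := j + 1) hj
        rwa [← add_assoc, pow_succ, mul_neg_one] at this)
      exact ⟨t, fun _ => ht⟩
    · exact ⟨0, fun hj' => absurd hj' hj⟩
  choose t ht using hex
  have hnodes : StrictMonoOn (nodes K y) (Set.Iic (2 * K + 6)) :=
    strictMonoOn_Iic_of_lt_succ fun j hj => h.nodes_lt_succ hj
  have hpre {k : ℕ} (hk : k < 2 * K + 4) : preimages K y k = nodes K y (k + 1) := by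
    unfold nodes
    rw [if_neg (by omega), if_pos (by omega), Nat.add_sub_cancel]
  have hn5 : nodes K y (2 * K + 5) = 5 := by simp [nodes]
  have hn6 : nodes K y (2 * K + 6) = 6 := by simp [nodes]
  have hbelow {j k : ℕ} (hj : j < 2 * K + 6) (hk : k < 2 * K + 4) (hkj : k < j) :
      preimages K y k < t j := by
    rw [hpre hk]
    exact (hnodes.monotoneOn (by simp; omega) (by simp; omega) (by omega)).trans_lt (ht j hj).1
  refine ⟨t, ?_, fun j hj => (ht j hj).2.2, ?_, ?_, ?_, ?_, ?_, ?_⟩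
  · intro i hi j hj hij
    simp only [Set.mem_Iio] at hi hj
    exact (ht i hi).2.1.trans_le ((hnodes.monotoneOn (by simp; omega) (by simp; omega)
      (by omega)).trans (ht j hj).1.le)
  · simpa [nodes] using (ht 0 (by omega)).1
  · exact hn5 ▸ (ht (2 * K + 4) (by omega)).2.1
  · exact hn5 ▸ (ht (2 * K + 5) (by omega)).1
  · exact hn6 ▸ (ht (2 * K + 5) (by omega)).2.1
  · intro j hj
    refine h.sign_comp hKn hj (fun k hk => hbelow (by omega) (by omega) hk) fun k hjk hk => ?_
    rw [hpre hk]
    exact (ht j (by omega)).2.1.trans_le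
      (hnodes.monotoneOn (by simp; omega) (by simp; omega) (by omega))
  · have := h.sign_comp hKn (j := 2 * K + 4) (t := t (2 * K + 5)) le_rfl
      (fun k hk => hbelow (by omega) hk (by omega)) (fun k hk hk' => by omega)
    rwa [neg_one_pow_congr (show Even (n + 2 + (2 * K + 4)) ↔ Even (n + 1 + 1) by grind)] at this

end RootChain

lemma exists_rootChain (n : ℕ) :
    ∃ K y, Even K ∧ K + 4 = 2 ^ (n + 2) ∧ RootChain n K y := by
  induction n with
  | zero =>
    obtain ⟨y, hy⟩ := rootChain_zero
    exact ⟨0, y, by simp, by norm_num, hy⟩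
  | succ n ih =>
    obtain ⟨K, y, hK, hKn, hy⟩ := ih
    obtain ⟨t, ht⟩ := hy.exists_succ hK hKn
    refine ⟨2 * K + 4, t, by grind, ?_, ht⟩
    rw [show n + 1 + 2 = n + 2 + 1 by ring, pow_succ, ← hKn]
    ring

lemma redP_ne_zero (n : ℕ) : redP n ≠ 0 := by
  intro h
  have := (redP_sign_nonpos n 0 le_rfl).1
  simp [h] at this

theorem statement_10 (m : ℕ) (hm : 2 ≤ m) (Pt : ℝ[X]) (hPt : Pt * Dp m = Qtp m) :
    ∃ mu : ℕ → ℝ,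
      StrictMonoOn mu (Set.Icc 1 (sm m)) ∧
      (∀ x : ℝ, Pt.eval x = 0 ↔ ∃ k : ℕ, 1 ≤ k ∧ k ≤ sm m ∧ mu k = x) ∧
      0 < mu 1 ∧ mu (sm m - 1) < 5 ∧ 5 < mu (sm m) ∧ mu (sm m) < 6 := by
  obtain ⟨n, rfl⟩ := Nat.exists_eq_add_of_le' hm
  have hD : Dp (n + 2) ≠ 0 := Finset.prod_ne_zero_iff.2 fun i _ => Fiter_ne_C i 2
  obtain rfl : Pt = redP (n + 1) := mul_right_cancel₀ hD (hPt.trans (redP_mul_Dp n).symm)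
  obtain ⟨K, y, -, hKn, hy⟩ := exists_rootChain n
  have hsm : sm (n + 2) = K + 2 := by unfold sm; omega
  have hdeg : (redP (n + 1)).natDegree ≤ K + 2 := by
    have : (redP (n + 1)).natDegree ≤ 2 ^ (n + 2) - 2 := natDegree_redP_le (n + 1)
    omega
  rw [hsm]
  refine ⟨fun k => y (k - 1), ?_, fun x => ⟨fun hx => ?_, ?_⟩, hy.pos, ?_, hy.five_lt, hy.lt_six⟩
  · intro i hi j hj hij
    simp only [Set.mem_Icc] at hi hj
    exact hy.strictMono (by simp; omega) (by simp; omega) (by omega)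
  · obtain ⟨c, hc⟩ := eval_eq_const_mul_prod hdeg hy.strictMono hy.root
    have hc0 : c ≠ 0 := by
      rintro rfl
      exact redP_ne_zero (n + 1) (Polynomial.funext fun z => by simp [hc])
    rw [hc] at hx
    obtain ⟨k, hk, hxk⟩ := Finset.prod_eq_zero_iff.1 ((mul_eq_zero.1 hx).resolve_left hc0)
    rw [Finset.mem_range] at hk
    exact ⟨k + 1, by omega, by omega, (sub_eq_zero.1 hxk).symm⟩
  · rintro ⟨k, hk1, hk2, rfl⟩
    exact hy.root _ (by omega)
  · exact hy.lt_five
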